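/- Let H be a self-adjoint operator and B a bounded self-adjoint operator on a Hilbert space satisfying e^{-itB} H e^{itB} = e^{t}·H on dom(H) for all t ∈ ℝ. Then the spectrum of H is invariant under multiplication by every positive real: σ(H) = e^{t}·σ(H) for all t. In particular, if σ(H) contains some nonzero point, then σ(H) ⊇ [0,∞) or σ(H) ⊇ (−∞,0]. -/

import Mathlib

/-- The spectrum of a (possibly unbounded) operator given as a `LinearPMap`:
`z` is in the spectrum iff `A - z` has no bounded two-sided inverse. -/
def pmapSpectrum {H : Type*} [NormedAddCommGroup H] [InnerProductSpace ℂ H]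
    (A : H →ₗ.[ℂ] H) : Set ℂ :=
  {z : ℂ | ¬ ∃ R : H →L[ℂ] H,
    (∀ φ : H, ∃ hm : R φ ∈ A.domain, A ⟨R φ, hm⟩ - z • R φ = φ) ∧
    (∀ φ : H, ∀ hφ : φ ∈ A.domain, R (A ⟨φ, hφ⟩ - z • φ) = φ)}


section ScalingHelpers

variable {H : Type*} [NormedAddCommGroup H] [InnerProductSpace ℂ H]

/-- `R` is the resolvent of `A` at `z`, phrased through the graph. -/
def GraphRes (A : H →ₗ.[ℂ] H) (z : ℂ) (R : H →L[ℂ] H) : Prop :=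
  (∀ φ : H, (R φ, φ + z • R φ) ∈ A.graph) ∧ ∀ x y : H, (x, y) ∈ A.graph → R (y - z • x) = x

theorem mem_graph_iff_exists (A : H →ₗ.[ℂ] H) (x y : H) :
    (x, y) ∈ A.graph ↔ ∃ h : x ∈ A.domain, A ⟨x, h⟩ = y := by
  rw [LinearPMap.mem_graph_iff]
  constructor
  · rintro ⟨⟨w, hw⟩, h1, h2⟩
    simp only at h1 h2
    subst h1
    exact ⟨hw, h2⟩
  · rintro ⟨h, h2⟩
    exact ⟨⟨x, h⟩, rfl, h2⟩

theorem mem_spec_iff (A : H →ₗ.[ℂ] H) (z : ℂ) :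
    z ∈ pmapSpectrum A ↔ ¬ ∃ R : H →L[ℂ] H, GraphRes A z R := by
  unfold pmapSpectrum GraphRes
  rw [Set.mem_ofPred_eq]
  apply not_congr
  apply exists_congr
  intro R
  simp only [mem_graph_iff_exists]
  apply and_congr
  · simp only [sub_eq_iff_eq_add]
  · constructor
    · rintro h x y ⟨hx, rfl⟩
      exact h x hx
    · intro h φ hφ
      exact h φ _ ⟨hφ, rfl⟩

theorem GraphRes.unique {A : H →ₗ.[ℂ] H} {z : ℂ} {R S : H →L[ℂ] H}
    (hR : GraphRes A z R) (hS : GraphRes A z S) : R = S := by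
  ext φ
  have := hR.2 _ _ (hS.1 φ)
  simpa using this

theorem GraphRes.scale {A : H →ₗ.[ℂ] H} {z : ℂ} {R : H →L[ℂ] H} (hR : GraphRes A z R)
    (c : ℂ) (hc : c ≠ 0) (V : H ≃ₗᵢ[ℂ] H)
    (hV : ∀ x y, (x, y) ∈ A.graph → (V x, c • V y) ∈ A.graph)
    (hV' : ∀ x y, (x, y) ∈ A.graph → (V.symm x, c⁻¹ • V.symm y) ∈ A.graph) :
    GraphRes A (c * z)
      (c⁻¹ • ((V : H →L[ℂ] H) ∘L R ∘L (V.symm : H →L[ℂ] H))) := by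
  constructor
  · intro φ
    have h := A.graph.smul_mem c⁻¹ (hV _ _ (hR.1 (V.symm φ)))
    convert h using 1
    ext
    · simp
    · simp [smul_smul, hc]
      congr 1
      field_simp
  · intro x y hxy
    have h := hR.2 _ _ (hV' x y hxy)
    have h2 : V.symm (y - (c * z) • x) = c • (c⁻¹ • V.symm y - z • V.symm x) := by
      simp [smul_sub, smul_smul, hc]
    simp [-map_sub, h2, h, smul_smul, hc]

variable [CompleteSpace H]

theorem sa_bound {A : H →ₗ.[ℂ] H} (hA : IsSelfAdjoint A) (z : ℂ) (x y : H)
    (h : (x, y) ∈ A.graph) : |z.im| * ‖x‖ ≤ ‖y - z • x‖ := by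
  obtain ⟨hx, rfl⟩ := (mem_graph_iff_exists _ _ _).1 h
  have hf : A.IsFormalAdjoint A := by
    have := LinearPMap.adjoint_isFormalAdjoint hA.dense_domain
    rwa [LinearPMap.isSelfAdjoint_def.mp hA] at this
  have h1 : inner ℂ (A ⟨x, hx⟩) x = inner ℂ x (A ⟨x, hx⟩) := hf ⟨x, hx⟩ ⟨x, hx⟩
  have him : (inner ℂ x (A ⟨x, hx⟩) : ℂ).im = 0 := by
    rw [← inner_conj_symm] at h1
    exact Complex.conj_eq_iff_im.1 h1
  have h2 : (inner ℂ x (A ⟨x, hx⟩ - z • x) : ℂ).im = - z.im * ‖x‖ ^ 2 := by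
    rw [inner_sub_right, inner_smul_right, inner_self_eq_norm_sq_to_K, Complex.sub_im, him]
    simp [← Complex.ofReal_pow]
  have h3 : |z.im| * ‖x‖ ^ 2 ≤ ‖x‖ * ‖A ⟨x, hx⟩ - z • x‖ := by
    calc |z.im| * ‖x‖ ^ 2 = |(inner ℂ x (A ⟨x, hx⟩ - z • x) : ℂ).im| := by
          rw [h2, abs_mul, abs_neg, abs_of_nonneg (sq_nonneg ‖x‖)]
      _ ≤ ‖(inner ℂ x (A ⟨x, hx⟩ - z • x) : ℂ)‖ := Complex.abs_im_le_norm _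
      _ ≤ _ := norm_inner_le_norm _ _
  rcases (norm_nonneg x).eq_or_lt with h0 | h0
  · rw [← h0]; simp
  · apply le_of_mul_le_mul_left _ h0
    linarith

theorem spec_real {A : H →ₗ.[ℂ] H} (hA : IsSelfAdjoint A) (z : ℂ)
    (hz : z ∈ pmapSpectrum A) : z.im = 0 := by
  by_contra him
  rw [mem_spec_iff] at hz
  apply hz
  have hpos : 0 < |z.im| := abs_pos.2 him
  have hcl : IsClosed (A.graph : Set (H × H)) := hA.isClosed
  have : CompleteSpace A.graph := hcl.completeSpace_coe
  let T : A.graph →L[ℂ] H :=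
    (ContinuousLinearMap.snd ℂ H H - z • ContinuousLinearMap.fst ℂ H H) ∘L A.graph.subtypeL
  have hT : ∀ p : A.graph, T p = p.1.2 - z • p.1.1 := fun p => rfl
  have hb : ∀ p : A.graph, ‖p.1.1‖ ≤ |z.im|⁻¹ * ‖T p‖ := by
    intro p
    rw [hT, ← div_eq_inv_mul, le_div_iff₀' hpos]
    exact sa_bound hA z _ _ p.2
  have hanti : AntilipschitzWith (Real.toNNReal (1 + (1 + ‖z‖) * |z.im|⁻¹)) T := by
    apply AddMonoidHomClass.antilipschitz_of_bound
    intro p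
    have hC : 0 ≤ |z.im|⁻¹ := by positivity
    rw [Real.coe_toNNReal _ (by positivity)]
    have h1 := hb p
    have h2 : ‖p.1.2‖ ≤ ‖T p‖ + ‖z‖ * ‖p.1.1‖ := by
      rw [← norm_smul, hT]
      simpa using norm_add_le (p.1.2 - z • p.1.1) (z • p.1.1)
    have h3 : ‖z‖ * ‖p.1.1‖ ≤ ‖z‖ * (|z.im|⁻¹ * ‖T p‖) := by gcongr
    have h4 : 0 ≤ |z.im|⁻¹ * ‖T p‖ := by positivity
    have h5 : 0 ≤ ‖z‖ * (|z.im|⁻¹ * ‖T p‖) := by positivity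
    have h6 := norm_nonneg (T p)
    change max ‖p.1.1‖ ‖p.1.2‖ ≤ _
    apply max_le <;> nlinarith
  have hrc : IsClosed (T.range : Set H) := hanti.isClosed_range T.uniformContinuous
  have horth : T.rangeᗮ = ⊥ := by
    rw [Submodule.eq_bot_iff]
    intro ψ hψ
    rw [Submodule.mem_orthogonal'] at hψ
    have h1 : ∀ x : A.domain, inner ℂ ((starRingEnd ℂ z) • ψ) (x : H) = inner ℂ ψ (A x) := by
      intro x
      have := hψ (T ⟨(x, A x), A.mem_graph x⟩) ⟨_, rfl⟩
      rw [hT, inner_sub_right, inner_smul_right, sub_eq_zero] at this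
      rw [inner_smul_left, this]
      simp
    have hd := LinearPMap.mem_adjoint_domain_of_exists (T := A) ψ ⟨_, h1⟩
    have he := LinearPMap.adjoint_apply_eq hA.dense_domain ⟨ψ, hd⟩ h1
    have hg : (ψ, (starRingEnd ℂ z) • ψ) ∈ A.adjoint.graph :=
      (mem_graph_iff_exists _ _ _).2 ⟨hd, he⟩
    rw [LinearPMap.isSelfAdjoint_def.mp hA] at hg
    have := sa_bound hA (starRingEnd ℂ z) _ _ hg
    rw [sub_self, norm_zero, Complex.conj_im, abs_neg] at this
    rw [← norm_le_zero_iff]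
    by_contra hn
    push Not at hn
    nlinarith [mul_pos hpos hn]
  have hsurj : T.range = ⊤ := by
    rw [← Submodule.topologicalClosure_eq_top_iff] at horth
    rwa [IsClosed.submodule_topologicalClosure_eq hrc] at horth
  have hinj : T.ker = ⊥ := LinearMap.ker_eq_bot.2 hanti.injective
  let e := ContinuousLinearEquiv.ofBijective T hinj hsurj
  refine ⟨(ContinuousLinearMap.fst ℂ H H) ∘L A.graph.subtypeL ∘L (e.symm : H →L[ℂ] A.graph),
    ?_, ?_⟩
  · intro φ
    have h1 : T (e.symm φ) = φ := e.apply_symm_apply φ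
    rw [hT, sub_eq_iff_eq_add] at h1
    have h2 := (e.symm φ).2
    change ((e.symm φ).1.1, φ + z • (e.symm φ).1.1) ∈ A.graph
    rw [← h1]
    exact h2
  · intro x y hxy
    have h1 : e.symm (T ⟨(x, y), hxy⟩) = ⟨(x, y), hxy⟩ := e.symm_apply_apply _
    rw [hT] at h1
    change (e.symm (y - z • x)).1.1 = x
    rw [h1]

end ScalingHelpers

/-- If a self-adjoint operator `H` satisfies `e^{-itB} H e^{itB} = e^t·H` on `dom H`
(with conjugation implemented by a one-parameter unitary group `U`), then its spectrum
satisfies `σ(H) = e^t·σ(H)` for all `t`; in particular, if `σ(H)` contains a nonzero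
point, then `σ(H) ⊇ [0,∞)` or `σ(H) ⊇ (-∞,0]`. -/
theorem spectrum_scaling_invariant
    {H : Type*} [NormedAddCommGroup H] [InnerProductSpace ℂ H] [CompleteSpace H]
    (Hop : H →ₗ.[ℂ] H) (hHop : IsSelfAdjoint Hop)
    (U : ℝ → H ≃ₗᵢ[ℂ] H) (hgrp : ∀ s t : ℝ, U (s + t) = (U s).trans (U t))
    (hhom : ∀ t : ℝ, ∀ φ : H, ∀ hφ : φ ∈ Hop.domain,
      ∃ hm : (U t) φ ∈ Hop.domain,
        (U (-t)) (Hop ⟨(U t) φ, hm⟩) = Real.exp t • Hop ⟨φ, hφ⟩) :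
    (∀ t : ℝ, pmapSpectrum Hop
        = (fun w : ℂ => (Real.exp t : ℂ) * w) '' pmapSpectrum Hop) ∧
    ((∃ w ∈ pmapSpectrum Hop, w ≠ 0) →
      ((fun x : ℝ => (x : ℂ)) '' Set.Ici 0 ⊆ pmapSpectrum Hop ∨
       (fun x : ℝ => (x : ℂ)) '' Set.Iic 0 ⊆ pmapSpectrum Hop)) := by
  have hU0 : ∀ x, U 0 x = x := by
    intro x
    have h := hgrp 0 0
    rw [add_zero] at h
    have h2 : U 0 x = U 0 (U 0 x) := by
      conv_lhs => rw [h]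
      rfl
    exact ((U 0).injective h2).symm
  have hUinv : ∀ t x, U (-t) (U t x) = x := by
    intro t x
    have h := hgrp t (-t)
    rw [add_neg_cancel] at h
    have h2 : U 0 x = U (-t) (U t x) := by rw [h]; rfl
    rw [← h2, hU0]
  have hsymm : ∀ t x, (U t).symm x = U (-t) x := by
    intro t x
    apply (U t).injective
    have := hUinv (-t) x
    rw [neg_neg] at this
    rw [this]; simp
  have hg : ∀ t x y, (x, y) ∈ Hop.graph → (U t x, (Real.exp t : ℂ) • U t y) ∈ Hop.graph := by
    intro t x y hxy
    obtain ⟨hx, rfl⟩ := (mem_graph_iff_exists _ _ _).1 hxy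
    obtain ⟨hm, h⟩ := hhom t x hx
    refine (mem_graph_iff_exists _ _ _).2 ⟨hm, ?_⟩
    rw [← hsymm, LinearIsometryEquiv.symm_apply_eq] at h
    rw [h, ← Complex.coe_smul, map_smul]
  have hexp : ∀ t : ℝ, (Real.exp t : ℂ) ≠ 0 := fun t => by
    exact_mod_cast (Real.exp_pos t).ne'
  have hinv : ∀ t : ℝ, (Real.exp t : ℂ)⁻¹ = (Real.exp (-t) : ℂ) := fun t => by
    rw [Real.exp_neg]; push_cast; rfl
  have hres : ∀ t z R, GraphRes Hop z R → GraphRes Hop (Real.exp t * z)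
      ((Real.exp t : ℂ)⁻¹ • (((U t : H ≃ₗᵢ[ℂ] H) : H →L[ℂ] H) ∘L R ∘L
        ((U t).symm : H →L[ℂ] H))) := by
    intro t z R hR
    refine hR.scale _ (hexp t) (U t) (hg t) ?_
    intro x y hxy
    rw [hsymm, hsymm, hinv]
    exact hg (-t) x y hxy
  have hsc : ∀ (t : ℝ) (z : ℂ), z ∈ pmapSpectrum Hop → (Real.exp t : ℂ) * z ∈ pmapSpectrum Hop := by
    intro t z hz
    rw [mem_spec_iff] at hz ⊢
    rintro ⟨R, hR⟩
    apply hz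
    have := hres (-t) _ _ hR
    rw [← mul_assoc, ← hinv, inv_mul_cancel₀ (hexp t), one_mul] at this
    exact ⟨_, this⟩
  refine ⟨?_, ?_⟩
  · intro t
    ext z
    constructor
    · intro hz
      refine ⟨_, hsc (-t) z hz, ?_⟩
      simp only
      rw [← mul_assoc, ← hinv, mul_inv_cancel₀ (hexp t), one_mul]
    · rintro ⟨w, hw, rfl⟩
      exact hsc t w hw
  · rintro ⟨w, hw, hw0⟩
    have him := spec_real hHop w hw
    obtain ⟨r, rfl⟩ : ∃ r : ℝ, w = (r : ℂ) := ⟨w.re, by apply Complex.ext <;> simp [him]⟩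
    have hr0 : r ≠ 0 := by exact_mod_cast hw0
    have hmul : ∀ a : ℝ, 0 < a → ((a * r : ℝ) : ℂ) ∈ pmapSpectrum Hop := by
      intro a ha
      have := hsc (Real.log a) _ hw
      rw [Real.exp_log ha] at this
      exact_mod_cast this
    have h0 : ((0 : ℝ) : ℂ) ∈ pmapSpectrum Hop := by
      rw [mem_spec_iff]
      rintro ⟨R, hR⟩
      rw [Complex.ofReal_zero] at hR
      have h1 := hres 1 _ _ hR
      rw [mul_zero] at h1
      have h2 := hR.unique h1
      have h3 : ‖R‖ ≤ Real.exp (-1) * ‖R‖ := by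
        refine ContinuousLinearMap.opNorm_le_bound _ (by positivity) ?_
        intro x
        have h4 : R x = (Real.exp (-1) : ℂ) • U 1 (R ((U 1).symm x)) := by
          conv_lhs => rw [h2, hinv]
          rfl
        rw [h4, norm_smul, LinearIsometryEquiv.norm_map, Complex.norm_real, Real.norm_eq_abs,
          abs_of_pos (Real.exp_pos _), mul_assoc]
        gcongr
        simpa using R.le_opNorm ((U 1).symm x)
      have h5 : Real.exp (-1) < 1 := by simp
      have hR0 : R = 0 := by
        rw [← norm_le_zero_iff]
        nlinarith [norm_nonneg R]
      have hz : ∀ φ : H, φ = 0 := by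
        intro φ
        have := hR.1 φ
        rw [hR0] at this
        simp only [ContinuousLinearMap.zero_apply, smul_zero, add_zero] at this
        exact Hop.graph_fst_eq_zero_snd this rfl
      rw [mem_spec_iff] at hw
      apply hw
      refine ⟨0, ?_, ?_⟩
      · intro φ
        rw [hz φ]
        simp
      · intro x y _
        rw [hz x]
        simp
    rcases lt_or_gt_of_ne hr0 with hr | hr
    · right
      rintro _ ⟨x, hx, rfl⟩
      rcases (Set.mem_Iic.1 hx).eq_or_lt with h | h
      · rw [h]; exact h0
      · have := hmul (x / r) (div_pos_of_neg_of_neg h hr)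
        rwa [div_mul_cancel₀ _ hr0] at this
    · left
      rintro _ ⟨x, hx, rfl⟩
      rcases (Set.mem_Ici.1 hx).eq_or_lt with h | h
      · rw [← h]; exact h0
      · have := hmul (x / r) (div_pos h hr)
        rwa [div_mul_cancel₀ _ hr0] at this
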